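/- arXiv:1806.04746 — 7 statements merged into one kernel-verified Lean document; each statement's English description precedes it below -/
import Mathlib

section
/- Suppose f is (σ,L)-strongly Bregman convex w.r.t. the Bregman divergence d_h with 0 < σ < L, x* is a minimizer of f on C, and the sequence (x^t) in C follows the mirror descent update x^{t+1} = argmin_{x∈C} { ⟨∇f(x^t), x − x^t⟩ + L·d_h(x, x^t) }. Then for every T ≥ 1: f(x^T) − f(x*) ≤ ( σ / ( (L/(L−σ))^T − 1 ) ) · d_h(x*, x^0). -/
open scoped RealInnerProductSpace

/-- The Bregman divergence generated by kernel `h` with gradient map `h'`: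
`d_h(x,y) = h(x) - h(y) - ⟪∇h(y), x - y⟫`. -/
noncomputable def bregmanDiv {n : ℕ} (h : EuclideanSpace ℝ (Fin n) → ℝ)
    (h' : EuclideanSpace ℝ (Fin n) → EuclideanSpace ℝ (Fin n))
    (x y : EuclideanSpace ℝ (Fin n)) : ℝ :=
  h x - h y - ⟪h' y, x - y⟫

theorem ConvexOn.bregmanDiv_nonneg {n : ℕ} {h : EuclideanSpace ℝ (Fin n) → ℝ}
    {h' : EuclideanSpace ℝ (Fin n) → EuclideanSpace ℝ (Fin n)}
    (hconv : ConvexOn ℝ Set.univ h) (x : EuclideanSpace ℝ (Fin n))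
    {y : EuclideanSpace ℝ (Fin n)} (hgrad : HasGradientAt h (h' y) y) :
    0 ≤ bregmanDiv h h' x y := by
  have hline : ConvexOn ℝ Set.univ (h ∘ AffineMap.lineMap (k := ℝ) y x) := by
    simpa using hconv.comp_affineMap (AffineMap.lineMap (k := ℝ) y x)
  have hderiv : HasDerivAt (h ∘ AffineMap.lineMap (k := ℝ) y x) ⟪h' y, x - y⟫ 0 := by
    have hy : HasFDerivAt h (InnerProductSpace.toDual ℝ _ (h' y))
        (AffineMap.lineMap (k := ℝ) y x (0 : ℝ)) := by
      simpa using hgrad.hasFDerivAt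
    simpa using hy.comp_hasDerivAt (0 : ℝ) AffineMap.hasDerivAt_lineMap
  have hslope := hline.le_slope_of_hasDerivAt (Set.mem_univ 0) (Set.mem_univ 1) zero_lt_one hderiv
  simp only [slope_def_field, Function.comp_apply, AffineMap.lineMap_apply_zero,
    AffineMap.lineMap_apply_one, sub_zero, div_one] at hslope
  unfold bregmanDiv
  linarith

/-- The variational inequality satisfied by a mirror descent step. -/
theorem inner_sub_le_of_isMinOn_bregmanDiv {n : ℕ} {C : Set (EuclideanSpace ℝ (Fin n))}
    (hC : Convex ℝ C) {h : EuclideanSpace ℝ (Fin n) → ℝ}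
    {h' : EuclideanSpace ℝ (Fin n) → EuclideanSpace ℝ (Fin n)}
    {g x y z : EuclideanSpace ℝ (Fin n)} {L : ℝ} (hgrad : HasGradientAt h (h' y) y)
    (hy : y ∈ C) (hz : z ∈ C)
    (hmin : IsMinOn (fun w => ⟪g, w - x⟫ + L * bregmanDiv h h' w x) C y) :
    ⟪g, y - z⟫ ≤
      L * (bregmanDiv h h' z x - bregmanDiv h h' z y - bregmanDiv h h' y x) := by
  have hlin (a : EuclideanSpace ℝ (Fin n)) :
      HasFDerivAt (fun w => ⟪a, w - x⟫) (InnerProductSpace.toDual ℝ _ a) y :=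
    (InnerProductSpace.toDual ℝ _ a).hasFDerivAt.comp y ((hasFDerivAt_id y).sub_const x)
  have hderiv := (hlin g).add
    (((hgrad.hasFDerivAt.sub_const (h x)).sub (hlin (h' x))).const_mul L)
  have hnonneg := hmin.localize.hasFDerivWithinAt_nonneg hderiv.hasFDerivWithinAt
    (sub_mem_posTangentConeAt_of_segment_subset (hC.segment_subset hy hz))
  simp only [bregmanDiv, add_apply, smul_apply,
    sub_apply, InnerProductSpace.toDual_apply_apply, inner_sub_right,
    smul_eq_mul] at hnonneg ⊢
  linarith

/-- Linear convergence of mirror descent for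
`(σ,L)`-strongly Bregman convex functions. -/
theorem mirror_descent_strong_bregman_linear_rate {n : ℕ}
    (C : Set (EuclideanSpace ℝ (Fin n))) (hCcpt : IsCompact C) (hCconv : Convex ℝ C)
    (h : EuclideanSpace ℝ (Fin n) → ℝ)
    (h' : EuclideanSpace ℝ (Fin n) → EuclideanSpace ℝ (Fin n))
    (hhconv : ConvexOn ℝ Set.univ h)
    (hhgrad : ∀ x, HasGradientAt h (h' x) x)
    (f : EuclideanSpace ℝ (Fin n) → ℝ)
    (f' : EuclideanSpace ℝ (Fin n) → EuclideanSpace ℝ (Fin n))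
    (hfgrad : ∀ x, HasGradientAt f (f' x) x)
    (σ L : ℝ) (hσ : 0 < σ) (hσL : σ < L)
    -- (σ,L)-strong Bregman convexity of f w.r.t. d_h
    (hsbc : ∀ y ∈ intrinsicInterior ℝ C, ∀ x ∈ C,
      f y + ⟪f' y, x - y⟫ + σ * bregmanDiv h h' x y ≤ f x ∧
      f x ≤ f y + ⟪f' y, x - y⟫ + L * bregmanDiv h h' x y)
    -- x* minimizes f over C
    (xstar : EuclideanSpace ℝ (Fin n)) (hxstarC : xstar ∈ C)
    (hxstarMin : IsMinOn f C xstar)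
    -- the mirror descent iterates
    (x : ℕ → EuclideanSpace ℝ (Fin n))
    (hxmem : ∀ t, x t ∈ intrinsicInterior ℝ C)
    (hupdate : ∀ t, IsMinOn
      (fun z => ⟪f' (x t), z - x t⟫ + L * bregmanDiv h h' z (x t)) C (x (t + 1)))
    (T : ℕ) (hT : 1 ≤ T) :
    f (x T) - f xstar ≤
      σ / ((L / (L - σ)) ^ T - 1) * bregmanDiv h h' xstar (x 0) := by
  have hmemC t : x t ∈ C := intrinsicInterior_subset (hxmem t)
  have hpos : 0 < L - σ := sub_pos.2 hσL
  have hD z t : 0 ≤ bregmanDiv h h' z (x t) := hhconv.bregmanDiv_nonneg z (hhgrad (x t))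
  have hstep t z (hz : z ∈ C) : f (x (t + 1)) - f z ≤
      (L - σ) * bregmanDiv h h' z (x t) - L * bregmanDiv h h' z (x (t + 1)) := by
    have hvar := inner_sub_le_of_isMinOn_bregmanDiv hCconv (hhgrad _) (hmemC (t + 1)) hz
      (hupdate t)
    have hupper := (hsbc _ (hxmem t) _ (hmemC (t + 1))).2
    have hlower := (hsbc _ (hxmem t) z hz).1
    simp only [inner_sub_right] at hvar hupper hlower
    linarith
  have hdescent t : f (x (t + 1)) ≤ f (x t) := by
    have hself : bregmanDiv h h' (x t) (x t) = 0 := by simp [bregmanDiv]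
    have := hstep t (x t) (hmemC t)
    rw [hself] at this
    linarith [mul_nonneg (hσ.trans hσL).le (hD (x t) (t + 1))]
  set r := L / (L - σ) with hr
  have hr1 : 1 < r := (one_lt_div hpos).2 (by linarith)
  have hpotential t : (r ^ t - 1) * (f (x t) - f xstar) + σ * r ^ t * bregmanDiv h h' xstar (x t)
      ≤ σ * bregmanDiv h h' xstar (x 0) := by
    induction t with
    | zero => simp
    | succ t ih =>
      have hmono : (r ^ t - 1) * f (x (t + 1)) ≤ (r ^ t - 1) * f (x t) :=
        mul_le_mul_of_nonneg_left (hdescent t) (sub_nonneg.2 (one_le_pow₀ hr1.le))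
      have hcontract : (r - 1) * (f (x (t + 1)) - f xstar) ≤
          σ * bregmanDiv h h' xstar (x t) - σ * r * bregmanDiv h h' xstar (x (t + 1)) := by
        have hscaled := mul_le_mul_of_nonneg_left (hstep t xstar hxstarC) (sub_nonneg.2 hr1.le)
        have hσr : (r - 1) * (L - σ) = σ := by rw [hr]; field_simp; ring
        have hLr : (r - 1) * L = σ * r := by rw [hr]; field_simp; ring
        linear_combination hscaled + bregmanDiv h h' xstar (x t) * hσr -
          bregmanDiv h h' xstar (x (t + 1)) * hLr
      have hscaled := mul_le_mul_of_nonneg_left hcontract (pow_nonneg (zero_le_one.trans hr1.le) t)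
      rw [pow_succ]
      linarith
  have hden : 0 < r ^ T - 1 := sub_pos.2 (one_lt_pow₀ hr1 (by omega))
  rw [div_mul_eq_mul_div, le_div_iff₀ hden]
  have : 0 ≤ σ * r ^ T * bregmanDiv h h' xstar (x T) :=
    mul_nonneg (mul_nonneg hσ.le (pow_nonneg (zero_le_one.trans hr1.le) T)) (hD xstar T)
  linarith [hpotential T]
end

section
/- Suppose f is L-Bregman convex w.r.t. the Bregman divergence d_h, x* is a minimizer of f on C, and x^T is the point reached after T ≥ 1 applications of the mirror descent update x^{t+1} = argmin_{x∈C} { ⟨∇f(x^t), x − x^t⟩ + L·d_h(x, x^t) } starting from x^0. Then f(x^T) − f(x*) ≤ L·d_h(x*, x^0) / T. -/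
open scoped RealInnerProductSpace

/-- Three-point inequality for the Bregman proximal step `z ↦ ⟪g, z - y⟫ + L * d_h(z, y)`. -/
theorem bregmanDiv_three_point_of_isMinOn {n : ℕ} {C : Set (EuclideanSpace ℝ (Fin n))}
    (hC : Convex ℝ C) {h : EuclideanSpace ℝ (Fin n) → ℝ}
    {h' : EuclideanSpace ℝ (Fin n) → EuclideanSpace ℝ (Fin n)} {L : ℝ}
    {g y p z : EuclideanSpace ℝ (Fin n)} (hgrad : HasGradientAt h (h' p) p)
    (hp : p ∈ C) (hz : z ∈ C)
    (hmin : IsMinOn (fun w => ⟪g, w - y⟫ + L * bregmanDiv h h' w y) C p) :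
    ⟪g, p - y⟫ + L * bregmanDiv h h' p y + L * bregmanDiv h h' z p ≤
      ⟪g, z - y⟫ + L * bregmanDiv h h' z y := by
  have hinner (v : EuclideanSpace ℝ (Fin n)) :
      HasFDerivAt (fun w => ⟪v, w - y⟫) (innerSL ℝ v) p := by
    simpa [Function.comp_def] using
      (innerSL ℝ v).hasFDerivAt.comp p ((hasFDerivAt_id p).sub_const y)
  have hderiv : HasFDerivAt (fun w => ⟪g, w - y⟫ + L * bregmanDiv h h' w y)
      (innerSL ℝ g + L • (innerSL ℝ (h' p) - innerSL ℝ (h' y))) p :=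
    (hinner g).add (((hgrad.hasFDerivAt.sub_const (h y)).sub (hinner (h' y))).const_mul L)
  have hfirst := hmin.localize.hasFDerivWithinAt_nonneg hderiv.hasFDerivWithinAt
    (sub_mem_posTangentConeAt_of_segment_subset (hC.segment_subset hp hz))
  simp only [add_apply, smul_apply, sub_apply, innerSL_apply_apply, smul_eq_mul,
    inner_sub_right] at hfirst
  simp only [bregmanDiv, inner_sub_right]
  linarith

/-- `O(1/T)` convergence of mirror descent for `L`-Bregman convex
functions. -/
theorem mirror_descent_bregman_sublinear_rate {n : ℕ}
    (C : Set (EuclideanSpace ℝ (Fin n))) (hCcpt : IsCompact C) (hCconv : Convex ℝ C)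
    (h : EuclideanSpace ℝ (Fin n) → ℝ)
    (h' : EuclideanSpace ℝ (Fin n) → EuclideanSpace ℝ (Fin n))
    (hhconv : ConvexOn ℝ Set.univ h)
    (hhgrad : ∀ x, HasGradientAt h (h' x) x)
    (f : EuclideanSpace ℝ (Fin n) → ℝ)
    (f' : EuclideanSpace ℝ (Fin n) → EuclideanSpace ℝ (Fin n))
    (hfgrad : ∀ x, HasGradientAt f (f' x) x)
    (L : ℝ) (hL : 0 < L)
    -- L-Bregman convexity of f w.r.t. d_h
    (hbc : ∀ y ∈ intrinsicInterior ℝ C, ∀ x ∈ C,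
      f y + ⟪f' y, x - y⟫ ≤ f x ∧
      f x ≤ f y + ⟪f' y, x - y⟫ + L * bregmanDiv h h' x y)
    -- x* minimizes f over C
    (xstar : EuclideanSpace ℝ (Fin n)) (hxstarC : xstar ∈ C)
    (hxstarMin : IsMinOn f C xstar)
    -- the mirror descent iterates
    (x : ℕ → EuclideanSpace ℝ (Fin n))
    (hxmem : ∀ t, x t ∈ intrinsicInterior ℝ C)
    (hupdate : ∀ t, IsMinOn
      (fun z => ⟪f' (x t), z - x t⟫ + L * bregmanDiv h h' z (x t)) C (x (t + 1)))
    (T : ℕ) (hT : 1 ≤ T) :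
    f (x T) - f xstar ≤ L * bregmanDiv h h' xstar (x 0) / T := by
  have hxC t : x t ∈ C := intrinsicInterior_subset (hxmem t)
  have hnonneg {y z} (hy : y ∈ intrinsicInterior ℝ C) (hz : z ∈ C) :
      0 ≤ L * bregmanDiv h h' z y := by
    linarith [(hbc y hy z hz).1, (hbc y hy z hz).2]
  have hstep t {z} (hz : z ∈ C) :
      f (x (t + 1)) + L * bregmanDiv h h' z (x (t + 1)) ≤
        f (x t) + ⟪f' (x t), z - x t⟫ + L * bregmanDiv h h' z (x t) := by
    linarith [(hbc (x t) (hxmem t) _ (hxC (t + 1))).2,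
      bregmanDiv_three_point_of_isMinOn hCconv (hhgrad _) (hxC (t + 1)) hz (hupdate t)]
  have hdescent t : f (x (t + 1)) ≤ f (x t) := by
    have hself := hstep t (hxC t)
    simp only [bregmanDiv, sub_self, inner_zero_right, mul_zero, add_zero] at hself
    have hpos := hnonneg (hxmem (t + 1)) (hxC t)
    simp only [bregmanDiv] at hpos
    linarith
  have hpotential (t : ℕ) :
      t * (f (x t) - f xstar) + L * bregmanDiv h h' xstar (x t) ≤
        L * bregmanDiv h h' xstar (x 0) := by
    induction t with
    | zero => simp
    | succ t ih =>
      have hmono := mul_le_mul_of_nonneg_left (hdescent t) (Nat.cast_nonneg (α := ℝ) t)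
      push_cast
      linarith [hstep t hxstarC, (hbc (x t) (hxmem t) xstar hxstarC).1]
  rw [le_div_iff₀ (by exact_mod_cast hT)]
  linarith [hpotential T, hnonneg (hxmem T) hxstarC]
end

section
/- Let g : C → ℝ be a convex function and d = d_h a Bregman divergence on C with kernel h. If x⁺ ∈ C minimizes x ↦ g(x) + d(x, y) over C (for fixed y ∈ rint(C), with x⁺ ∈ rint(C)), then for every x ∈ C: g(x⁺) + d(x⁺, y) + d(x, x⁺) ≤ g(x) + d(x, y). -/
open scoped RealInnerProductSpace

/-- First-order optimality condition for a minimizer over `C` of a sum `g + f` with `g` convex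
and `f` differentiable. -/
theorem IsMinOn.sub_add_inner_gradient_nonneg {E : Type*} [NormedAddCommGroup E]
    [InnerProductSpace ℝ E] [CompleteSpace E] {C : Set E} {g f : E → ℝ} {f' p x : E}
    (hmin : IsMinOn (fun z => g z + f z) C p) (hg : ConvexOn ℝ C g)
    (hf : HasGradientAt f f' p) (hp : p ∈ C) (hx : x ∈ C) :
    0 ≤ g x - g p + ⟪f', x - p⟫ := by
  have hline : HasDerivAt (fun t : ℝ => p + t • (x - p)) (x - p) 0 := by
    simpa using ((hasDerivAt_id (0 : ℝ)).smul_const (x - p)).const_add p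
  have hcomp : HasDerivAt (fun t : ℝ => f (p + t • (x - p))) ⟪f', x - p⟫ 0 := by
    have hf0 : HasFDerivAt f (InnerProductSpace.toDual ℝ E f') (p + (0 : ℝ) • (x - p)) := by
      simpa using hf.hasFDerivAt
    exact hf0.comp_hasDerivAt (0 : ℝ) hline
  have hslope := hcomp.tendsto_slope_zero_right
  suffices g p - g x ≤ ⟪f', x - p⟫ by linarith
  refine ge_of_tendsto hslope ?_
  filter_upwards [Ioo_mem_nhdsGT (zero_lt_one' ℝ)] with t ht
  have hcomb : (1 - t) • p + t • x = p + t • (x - p) := by module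
  have h1 : 0 ≤ 1 - t := by linarith [ht.2]
  have hmem : p + t • (x - p) ∈ C :=
    hcomb ▸ hg.1 hp hx h1 ht.1.le (by ring)
  have hconv := hg.2 hp hx h1 ht.1.le (by ring)
  rw [hcomb] at hconv
  have hle : g p + f p ≤ g (p + t • (x - p)) + f (p + t • (x - p)) := hmin hmem
  simp only [smul_eq_mul, zero_add, zero_smul, add_zero] at hconv ⊢
  rw [inv_mul_eq_div, le_div_iff₀ ht.1]
  linarith

/-- The Bregman divergence is differentiable in its first argument. -/
theorem hasGradientAt_bregmanDiv {n : ℕ} {h : EuclideanSpace ℝ (Fin n) → ℝ}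
    {h' : EuclideanSpace ℝ (Fin n) → EuclideanSpace ℝ (Fin n)} {x : EuclideanSpace ℝ (Fin n)}
    (hx : HasGradientAt h (h' x) x) (y : EuclideanSpace ℝ (Fin n)) :
    HasGradientAt (fun z => bregmanDiv h h' z y) (h' x - h' y) x := by
  rw [hasGradientAt_iff_hasFDerivAt, map_sub]
  exact (hx.hasFDerivAt.sub_const (h y)).sub
    ((InnerProductSpace.toDual ℝ _ (h' y)).hasFDerivAt.comp x ((hasFDerivAt_id x).sub_const y))

/-- Chen–Teboulle. The three-point property of the Bregman
proximal step: if `x⁺` minimizes `g(x) + d(x,y)` over `C` then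
`g(x⁺) + d(x⁺,y) + d(x,x⁺) ≤ g(x) + d(x,y)` for all `x ∈ C`. -/
theorem bregman_three_point_property {n : ℕ}
    (C : Set (EuclideanSpace ℝ (Fin n))) (hCcpt : IsCompact C) (hCconv : Convex ℝ C)
    (h : EuclideanSpace ℝ (Fin n) → ℝ)
    (h' : EuclideanSpace ℝ (Fin n) → EuclideanSpace ℝ (Fin n))
    (hhconv : ConvexOn ℝ Set.univ h)
    (hhgrad : ∀ x, HasGradientAt h (h' x) x)
    (g : EuclideanSpace ℝ (Fin n) → ℝ) (hg : ConvexOn ℝ C g)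
    (y : EuclideanSpace ℝ (Fin n)) (hy : y ∈ intrinsicInterior ℝ C)
    (xplus : EuclideanSpace ℝ (Fin n)) (hxplus : xplus ∈ intrinsicInterior ℝ C)
    (hmin : IsMinOn (fun x => g x + bregmanDiv h h' x y) C xplus) :
    ∀ x ∈ C,
      g xplus + bregmanDiv h h' xplus y + bregmanDiv h h' x xplus ≤
        g x + bregmanDiv h h' x y := by
  intro x hx
  have hopt := hmin.sub_add_inner_gradient_nonneg hg (hasGradientAt_bregmanDiv (hhgrad xplus) y)
    (intrinsicInterior_subset hxplus) hx
  simp only [bregmanDiv, inner_sub_left, inner_sub_right] at hopt ⊢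
  linarith
end

section
/- Suppose f is L-Bregman convex w.r.t. the Bregman divergence d_h, and x^{t+1} = argmin_{x∈C} { ⟨∇f(x^t), x − x^t⟩ + L·d_h(x, x^t) } is the mirror descent update of x^t ∈ rint(C). Then f(x^{t+1}) ≤ f(x^t). -/
open scoped RealInnerProductSpace

/-- For an `L`-Bregman convex function, a mirror descent step does
not increase the function value: `f(x^{t+1}) ≤ f(x^t)`. -/
theorem mirror_descent_step_decreases {n : ℕ}
    (C : Set (EuclideanSpace ℝ (Fin n))) (hCcpt : IsCompact C) (hCconv : Convex ℝ C)
    (h : EuclideanSpace ℝ (Fin n) → ℝ)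
    (h' : EuclideanSpace ℝ (Fin n) → EuclideanSpace ℝ (Fin n))
    (hhconv : ConvexOn ℝ Set.univ h)
    (hhgrad : ∀ x, HasGradientAt h (h' x) x)
    (f : EuclideanSpace ℝ (Fin n) → ℝ)
    (f' : EuclideanSpace ℝ (Fin n) → EuclideanSpace ℝ (Fin n))
    (hfgrad : ∀ x, HasGradientAt f (f' x) x)
    (L : ℝ) (hL : 0 < L)
    -- L-Bregman convexity of f w.r.t. d_h
    (hbc : ∀ y ∈ intrinsicInterior ℝ C, ∀ x ∈ C,
      f y + ⟪f' y, x - y⟫ ≤ f x ∧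
      f x ≤ f y + ⟪f' y, x - y⟫ + L * bregmanDiv h h' x y)
    (xt : EuclideanSpace ℝ (Fin n)) (hxt : xt ∈ intrinsicInterior ℝ C)
    (xnext : EuclideanSpace ℝ (Fin n)) (hxnext : xnext ∈ C)
    (hupdate : IsMinOn
      (fun z => ⟪f' xt, z - xt⟫ + L * bregmanDiv h h' z xt) C xnext) :
    f xnext ≤ f xt := by
  have hmin := hupdate (intrinsicInterior_subset hxt)
  have hupper := (hbc xt hxt xnext hxnext).2
  simp only [Set.mem_ofPred_eq, bregmanDiv, sub_self, inner_zero_right, mul_zero, add_zero]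
    at hmin hupper
  linarith
end

section
/- For any two feasible spending vectors b and b' with b' entrywise positive, the potential Φ satisfies the sandwich inequality: Σ_{i finite} ((1−ρ_i)/ρ_i)·KL(b_i ‖ b_i') − Σ_{i Leontief} KL(b_i ‖ b_i') ≤ Φ(b) − Φ(b') − ⟨∇Φ(b'), b − b'⟩ ≤ Σ_{i finite} (1/ρ_i)·KL(b_i ‖ b_i'), where 'finite' ranges over buyers with ρ_i ∈ [−∞,1], ρ_i ∉ {0,−∞} and 'Leontief' over buyers with ρ_i = −∞. -/
open Finset

/-- Price of good `j` given spending `b`. -/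
noncomputable def price {m n : ℕ} (b : Fin m → Fin n → ℝ) (j : Fin n) : ℝ :=
  ∑ i, b i j

/-- KL divergence between two nonnegative vectors. -/
noncomputable def KL {n : ℕ} (x y : Fin n → ℝ) : ℝ :=
  ∑ j, x j * Real.log (x j / y j)

/-- Feasible spending: nonnegative entries, each buyer spends exactly her budget. -/
def Feasible {m n : ℕ} (e : Fin m → ℝ) (b : Fin m → Fin n → ℝ) : Prop :=
  ∀ i, (∀ j, 0 ≤ b i j) ∧ ∑ j, b i j = e i

/-- The potential `Φ`, where `Leo` is the set of Leontief buyers (`ρ_i = -∞`, with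
coefficients `c`), and the remaining buyers have finite CES parameter `ρ_i ∉ {0, -∞}`
and coefficients `a`. -/
noncomputable def PhiFull {m n : ℕ} (Leo : Finset (Fin m))
    (a c : Fin m → Fin n → ℝ) (ρ : Fin m → ℝ) (b : Fin m → Fin n → ℝ) : ℝ :=
  (-∑ i ∈ Leoᶜ,
      (1 / ρ i) * ∑ j, b i j * Real.log (a i j * b i j ^ (ρ i - 1) / price b j ^ ρ i)) -
    ∑ i ∈ Leo, ∑ j, b i j * Real.log (b i j / (c i j * price b j))

/-- The gradient `∇_{b_ij} Φ` of the potential `PhiFull`. -/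
noncomputable def gradPhiFull {m n : ℕ} (Leo : Finset (Fin m))
    (a c : Fin m → Fin n → ℝ) (ρ : Fin m → ℝ) (b : Fin m → Fin n → ℝ)
    (i : Fin m) (j : Fin n) : ℝ :=
  if i ∈ Leo then -Real.log (b i j / (c i j * price b j))
  else (1 / ρ i) * (1 - Real.log (a i j * b i j ^ (ρ i - 1) / price b j ^ ρ i))

/-- Tangent-line form of the convexity of `x * log x`. -/
lemma sub_le_mul_log_div {x y : ℝ} (hx : 0 ≤ x) (hy : 0 < y) :
    x - y ≤ x * Real.log (x / y) := by
  rcases hx.eq_or_lt with rfl | hx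
  · simpa using hy.le
  · have h := mul_le_mul_of_nonneg_left (Real.one_sub_inv_le_log_of_pos (div_pos hx hy)) hx.le
    have h2 : x * (1 - (x / y)⁻¹) = x - y := by field_simp
    linarith

/-- Gibbs' inequality. -/
lemma sum_mul_log_div_nonneg {ι : Type*} (s : Finset ι) {x y : ι → ℝ}
    (hx : ∀ i ∈ s, 0 ≤ x i) (hy : ∀ i ∈ s, 0 < y i) (hxy : ∑ i ∈ s, x i = ∑ i ∈ s, y i) :
    0 ≤ ∑ i ∈ s, x i * Real.log (x i / y i) := by
  have h := Finset.sum_le_sum fun i hi => sub_le_mul_log_div (hx i hi) (hy i hi)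
  rwa [Finset.sum_sub_distrib, hxy, sub_self] at h

/-- The log-sum inequality. -/
lemma sum_mul_log_sum_div_sum_le {ι : Type*} (s : Finset ι) {x y : ι → ℝ}
    (hx : ∀ i ∈ s, 0 ≤ x i) (hy : ∀ i ∈ s, 0 < y i) :
    (∑ i ∈ s, x i) * Real.log ((∑ i ∈ s, x i) / ∑ i ∈ s, y i) ≤
      ∑ i ∈ s, x i * Real.log (x i / y i) := by
  rcases (Finset.sum_nonneg hx).eq_or_lt with h0 | hX
  · have hz := (Finset.sum_eq_zero_iff_of_nonneg hx).1 h0.symm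
    rw [← h0, zero_mul, Finset.sum_eq_zero fun i hi => by rw [hz i hi, zero_mul]]
  have hs : s.Nonempty := by
    by_contra h
    simp [Finset.not_nonempty_iff_eq_empty.1 h] at hX
  have hY : 0 < ∑ i ∈ s, y i := Finset.sum_pos hy hs
  set t := (∑ i ∈ s, x i) / ∑ i ∈ s, y i with ht
  have htpos : 0 < t := div_pos hX hY
  have hg := sum_mul_log_div_nonneg s hx (y := fun i => t * y i)
    (fun i hi => mul_pos htpos (hy i hi))
    (by rw [← Finset.mul_sum, ht, div_mul_cancel₀ _ hY.ne'])
  have hterm : ∀ i ∈ s, x i * Real.log (x i / (t * y i)) =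
      x i * Real.log (x i / y i) - x i * Real.log t := by
    intro i hi
    rcases (hx i hi).eq_or_lt with h | h
    · simp [← h]
    · rw [mul_comm t, ← div_div, Real.log_div (div_pos h (hy i hi)).ne' htpos.ne']
      ring
  rw [Finset.sum_congr rfl hterm, Finset.sum_sub_distrib, ← Finset.sum_mul] at hg
  linarith

lemma mul_log_ces_sub {a r x y p q : ℝ} (ha : 0 < a) (hx : 0 ≤ x) (hy : 0 < y)
    (hp : x ≤ p) (hq : 0 < q) :
    x * (Real.log (a * x ^ (r - 1) / p ^ r) - Real.log (a * y ^ (r - 1) / q ^ r)) =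
      (r - 1) * (x * Real.log (x / y)) - r * (x * Real.log (p / q)) := by
  rcases hx.eq_or_lt with rfl | hx
  · simp
  have hp0 : 0 < p := hx.trans_le hp
  rw [Real.log_div (by positivity) (by positivity), Real.log_div (by positivity) (by positivity),
    Real.log_mul ha.ne' (by positivity), Real.log_mul ha.ne' (by positivity),
    Real.log_rpow hx, Real.log_rpow hy, Real.log_rpow hp0, Real.log_rpow hq,
    Real.log_div hx.ne' hy.ne', Real.log_div hp0.ne' hq.ne']
  ring

lemma mul_log_leontief_sub {c x y p q : ℝ} (hc : 0 < c) (hx : 0 ≤ x) (hy : 0 < y)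
    (hp : x ≤ p) (hq : 0 < q) :
    x * (Real.log (x / (c * p)) - Real.log (y / (c * q))) =
      x * Real.log (x / y) - x * Real.log (p / q) := by
  rcases hx.eq_or_lt with rfl | hx
  · simp
  have hp0 : 0 < p := hx.trans_le hp
  rw [Real.log_div (by positivity) (by positivity), Real.log_div (by positivity) (by positivity),
    Real.log_mul hc.ne' (by positivity), Real.log_mul hc.ne' (by positivity),
    Real.log_div hx.ne' hy.ne', Real.log_div hp0.ne' hq.ne']
  ring

/-- The Bregman residual of `PhiFull` is a combination of the buyers' divergences plus the
divergence of the price vectors. -/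
lemma PhiFull_residual_eq {m n : ℕ} (Leo : Finset (Fin m)) {e : Fin m → ℝ}
    {a c : Fin m → Fin n → ℝ}
    (ha : ∀ i ∉ Leo, ∀ j, 0 < a i j) (hc : ∀ i ∈ Leo, ∀ j, 0 < c i j)
    {ρ : Fin m → ℝ} (hρ : ∀ i ∉ Leo, ρ i ≠ 0) {b b' : Fin m → Fin n → ℝ}
    (hb : Feasible e b) (hb' : Feasible e b') (hb'pos : ∀ i j, 0 < b' i j) :
    PhiFull Leo a c ρ b - PhiFull Leo a c ρ b' -
        ∑ i, ∑ j, gradPhiFull Leo a c ρ b' i j * (b i j - b' i j) =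
      (∑ i ∈ Leoᶜ, ((1 - ρ i) / ρ i) * KL (b i) (b' i)) - ∑ i ∈ Leo, KL (b i) (b' i) +
        KL (price b) (price b') := by
  have hle : ∀ i j, b i j ≤ price b j := fun i j =>
    Finset.single_le_sum (f := fun i => b i j) (fun k _ => (hb k).1 j) (Finset.mem_univ i)
  have hq : ∀ (_ : Fin m) j, 0 < price b' j := fun i j =>
    Finset.sum_pos (fun k _ => hb'pos k j) ⟨i, Finset.mem_univ i⟩
  have hP : KL (price b) (price b') =
      ∑ i ∈ Leoᶜ, ∑ j, b i j * Real.log (price b j / price b' j) +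
        ∑ i ∈ Leo, ∑ j, b i j * Real.log (price b j / price b' j) := by
    rw [Finset.sum_compl_add_sum, Finset.sum_comm]
    refine Finset.sum_congr rfl fun j _ => ?_
    rw [← Finset.sum_mul, price]
  rw [hP, ← Finset.sum_compl_add_sum Leo fun i =>
    ∑ j, gradPhiFull Leo a c ρ b' i j * (b i j - b' i j)]
  have hfin : ∀ i ∈ Leoᶜ,
      -((1 / ρ i) * ∑ j, b i j * Real.log (a i j * b i j ^ (ρ i - 1) / price b j ^ ρ i)) +
        (1 / ρ i) * ∑ j, b' i j * Real.log (a i j * b' i j ^ (ρ i - 1) / price b' j ^ ρ i) -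
        ∑ j, gradPhiFull Leo a c ρ b' i j * (b i j - b' i j) =
      ((1 - ρ i) / ρ i) * KL (b i) (b' i) +
        ∑ j, b i j * Real.log (price b j / price b' j) := by
    intro i hi
    have hi' : i ∉ Leo := Finset.mem_compl.1 hi
    have hr := hρ i hi'
    have hsum : ∑ j, (1 / ρ i) * (b i j - b' i j) = 0 := by
      rw [← Finset.mul_sum, Finset.sum_sub_distrib, (hb i).2, (hb' i).2, sub_self, mul_zero]
    rw [← add_zero (_ + _), ← hsum, KL]
    simp only [Finset.mul_sum, ← Finset.sum_neg_distrib, ← Finset.sum_add_distrib,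
      ← Finset.sum_sub_distrib]
    refine Finset.sum_congr rfl fun j _ => ?_
    have h := mul_log_ces_sub (r := ρ i) (ha i hi' j) ((hb i).1 j) (hb'pos i j) (hle i j) (hq i j)
    rw [gradPhiFull, if_neg hi']
    field_simp
    linear_combination -h
  have hleo : ∀ i ∈ Leo,
      -(∑ j, b i j * Real.log (b i j / (c i j * price b j))) +
        ∑ j, b' i j * Real.log (b' i j / (c i j * price b' j)) -
        ∑ j, gradPhiFull Leo a c ρ b' i j * (b i j - b' i j) =
      -KL (b i) (b' i) + ∑ j, b i j * Real.log (price b j / price b' j) := by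
    intro i hi
    rw [KL]
    simp only [← Finset.sum_neg_distrib, ← Finset.sum_add_distrib, ← Finset.sum_sub_distrib]
    refine Finset.sum_congr rfl fun j _ => ?_
    have h := mul_log_leontief_sub (hc i hi j) ((hb i).1 j) (hb'pos i j) (hle i j) (hq i j)
    rw [gradPhiFull, if_pos hi]
    linear_combination -h
  have h1 := Finset.sum_congr rfl hfin
  have h2 := Finset.sum_congr rfl hleo
  simp only [Finset.sum_add_distrib, Finset.sum_sub_distrib, Finset.sum_neg_distrib] at h1 h2
  simp only [PhiFull]
  linarith

/-- The sandwich inequality for the potential `Φ`: the Bregman-type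
residual of `Φ` is bounded below and above by weighted KL divergences of the buyers'
spendings. -/
theorem Phi_sandwich_inequality {m n : ℕ}
    (Leo : Finset (Fin m))
    (e : Fin m → ℝ) (he : ∀ i, 0 < e i)
    (a c : Fin m → Fin n → ℝ)
    (ha : ∀ i ∉ Leo, ∀ j, 0 < a i j) (hc : ∀ i ∈ Leo, ∀ j, 0 < c i j)
    (ρ : Fin m → ℝ) (hρ : ∀ i ∉ Leo, ρ i ≤ 1 ∧ ρ i ≠ 0)
    (b b' : Fin m → Fin n → ℝ)
    (hb : Feasible e b) (hb' : Feasible e b') (hb'pos : ∀ i j, 0 < b' i j) :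
    ((∑ i ∈ Leoᶜ, ((1 - ρ i) / ρ i) * KL (b i) (b' i)) -
        ∑ i ∈ Leo, KL (b i) (b' i) ≤
      PhiFull Leo a c ρ b - PhiFull Leo a c ρ b' -
        ∑ i, ∑ j, gradPhiFull Leo a c ρ b' i j * (b i j - b' i j)) ∧
    PhiFull Leo a c ρ b - PhiFull Leo a c ρ b' -
        ∑ i, ∑ j, gradPhiFull Leo a c ρ b' i j * (b i j - b' i j) ≤
      ∑ i ∈ Leoᶜ, (1 / ρ i) * KL (b i) (b' i) := by
  have hprice : ∀ j, ∀ i ∈ (Finset.univ : Finset (Fin m)), 0 ≤ b i j := fun j i _ => (hb i).1 j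
  rw [PhiFull_residual_eq Leo ha hc (fun i hi => (hρ i hi).2) hb hb' hb'pos]
  constructor
  · refine le_add_of_nonneg_right ?_
    rcases isEmpty_or_nonempty (Fin m) with hm | hm
    · simp [KL, price]
    refine sum_mul_log_div_nonneg _ (fun j _ => Finset.sum_nonneg (hprice j))
      (fun j _ => Finset.sum_pos (fun i _ => hb'pos i j) Finset.univ_nonempty) ?_
    simp only [price]
    rw [Finset.sum_comm, Finset.sum_comm (f := fun j i => b' i j)]
    exact Finset.sum_congr rfl fun i _ => (hb i).2.trans (hb' i).2.symm
  · have hKL : KL (price b) (price b') ≤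
        ∑ i ∈ Leoᶜ, KL (b i) (b' i) + ∑ i ∈ Leo, KL (b i) (b' i) := by
      rw [Finset.sum_compl_add_sum]
      simp only [KL]
      rw [Finset.sum_comm]
      exact Finset.sum_le_sum fun j _ =>
        sum_mul_log_sum_div_sum_le _ (hprice j) fun i _ => hb'pos i j
    have hsplit : ∑ i ∈ Leoᶜ, (1 / ρ i) * KL (b i) (b' i) =
        ∑ i ∈ Leoᶜ, ((1 - ρ i) / ρ i) * KL (b i) (b' i) + ∑ i ∈ Leoᶜ, KL (b i) (b' i) := by
      rw [← Finset.sum_add_distrib]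
      refine Finset.sum_congr rfl fun i hi => ?_
      have hr := (hρ i (Finset.mem_compl.1 hi)).2
      field_simp
      ring
    linarith
end

section
/- In a Fisher market where every buyer has a CES substitutes utility u_i(x_i) = (Σ_j a_ij x_ij^{ρ_i})^{1/ρ_i} with 0 < ρ_i ≤ 1, a feasible spending vector b is an equilibrium spending — i.e., setting p_j = Σ_i b_ij and x_ij = b_ij/p_j, for each buyer i the bundle x_i maximizes u_i over { x ∈ ℝ_+^n : Σ_j p_j x_j ≤ e_i } — if and only if b minimizes the potential Φ over the feasible set. -/
open Finset

/-- The potential function `Φ` for CES substitutes buyers. -/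
noncomputable def Phi {m n : ℕ} (a : Fin m → Fin n → ℝ) (ρ : Fin m → ℝ)
    (b : Fin m → Fin n → ℝ) : ℝ :=
  -∑ i, (1 / ρ i) * ∑ j, b i j * Real.log (a i j * b i j ^ (ρ i - 1) / price b j ^ ρ i)


/-- Logarithm of the cost per unit of marginal utility, up to normalization: if a buyer with
coefficient `a` and exponent `ρ` spends `s` on a good of price `p`, her marginal utility of money
is proportional to `exp (-ρ * logCost a ρ p s)`. -/
noncomputable def logCost (a ρ p s : ℝ) : ℝ :=
  Real.log p - Real.log a / ρ + (1 / ρ - 1) * Real.log s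

/-- First-order optimality: every buyer spends only on goods of minimal `logCost`, and spends on
all goods if her utility is strictly concave. -/
def MinimizesLogCost {m n : ℕ} (a : Fin m → Fin n → ℝ) (ρ : Fin m → ℝ)
    (b : Fin m → Fin n → ℝ) : Prop :=
  ∀ i j k, 0 < b i j →
    (ρ i < 1 → 0 < b i k) ∧
      logCost (a i j) (ρ i) (price b j) (b i j) ≤ logCost (a i k) (ρ i) (price b k) (b i k)

/-- Move the amount `t` from coordinate `j` to coordinate `k`. -/
def transfer {n : ℕ} (v : Fin n → ℝ) (j k : Fin n) (t : ℝ) : Fin n → ℝ :=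
  fun l => v l + t * ((if l = k then 1 else 0) - (if l = j then 1 else 0))

section Transfer

variable {n : ℕ} {v : Fin n → ℝ} {j k : Fin n} {t : ℝ}

lemma transfer_source (hjk : j ≠ k) : transfer v j k t j = v j - t := by
  simp [transfer, hjk]; ring

lemma transfer_target (hjk : j ≠ k) : transfer v j k t k = v k + t := by
  simp [transfer, hjk.symm]

lemma transfer_of_ne {l : Fin n} (hj : l ≠ j) (hk : l ≠ k) : transfer v j k t l = v l := by
  simp [transfer, hj, hk]

lemma sum_mul_transfer (f : Fin n → ℝ) :
    ∑ l, f l * transfer v j k t l = ∑ l, f l * v l + t * (f k - f j) := by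
  simp only [transfer, mul_add, sum_add_distrib, mul_sub, sum_sub_distrib]
  simp
  ring

lemma sum_transfer : ∑ l, transfer v j k t l = ∑ l, v l := by
  simpa using sum_mul_transfer (v := v) (j := j) (k := k) (t := t) (fun _ => 1)

lemma transfer_nonneg (hv : ∀ l, 0 ≤ v l) (hjk : j ≠ k) (ht : 0 ≤ t) (htj : t ≤ v j) (l : Fin n) :
    0 ≤ transfer v j k t l := by
  by_cases hj : l = j
  · subst hj
    rw [transfer_source hjk]
    linarith
  by_cases hk : l = k
  · subst hk
    rw [transfer_target hjk]
    linarith [hv l]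
  · rw [transfer_of_ne hj hk]
    exact hv l

lemma transfer_pos (hjk : j ≠ k) (ht : 0 ≤ t) (htj : t < v j) {l : Fin n} (hl : 0 < v l) :
    0 < transfer v j k t l := by
  by_cases hj : l = j
  · subst hj
    rw [transfer_source hjk]
    linarith
  by_cases hk : l = k
  · subst hk
    rw [transfer_target hjk]
    linarith
  · rwa [transfer_of_ne hj hk]

end Transfer

section Market

variable {m n : ℕ} {e : Fin m → ℝ} {b : Fin m → Fin n → ℝ}

lemma price_update_transfer (b : Fin m → Fin n → ℝ) (i : Fin m) (j k : Fin n) (t : ℝ) :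
    price (Function.update b i (transfer (b i) j k t)) = transfer (price b) j k t := by
  funext l
  have h : ∀ i', Function.update b i (transfer (b i) j k t) i' l = b i' l +
      if i' = i then t * ((if l = k then 1 else 0) - (if l = j then 1 else 0)) else 0 := by
    intro i'
    by_cases hi : i' = i
    · subst hi
      simp [transfer]
    · simp [hi]
  simp only [price, h, sum_add_distrib]
  simp [transfer, price]

lemma Feasible.le_price (hb : Feasible e b) (i : Fin m) (j : Fin n) : b i j ≤ price b j :=
  single_le_sum (f := fun i => b i j) (fun i' _ => (hb i').1 j) (mem_univ i)

lemma Feasible.price_nonneg (hb : Feasible e b) (j : Fin n) : 0 ≤ price b j :=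
  sum_nonneg fun i _ => (hb i).1 j

lemma Feasible.update_transfer (hb : Feasible e b) {i : Fin m} {j k : Fin n} {t : ℝ} (hjk : j ≠ k)
    (ht : 0 ≤ t) (htj : t ≤ b i j) :
    Feasible e (Function.update b i (transfer (b i) j k t)) := by
  intro i'
  by_cases hi : i' = i
  · subst hi
    simp only [Function.update_self]
    exact ⟨transfer_nonneg (hb i').1 hjk ht htj, sum_transfer.trans (hb i').2⟩
  · simpa [hi] using hb i'

lemma Feasible.Phi_eq {a : Fin m → Fin n → ℝ} {ρ : Fin m → ℝ} (hb : Feasible e b)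
    (ha : ∀ i j, 0 < a i j) (hρ : ∀ i, 0 < ρ i) :
    Phi a ρ b = ∑ i, ∑ j, b i j * logCost (a i j) (ρ i) (price b j) (b i j) := by
  rw [Phi, ← sum_neg_distrib]
  refine sum_congr rfl fun i _ => ?_
  rw [mul_sum, ← sum_neg_distrib]
  refine sum_congr rfl fun j _ => ?_
  rcases ((hb i).1 j).eq_or_lt with h | h
  · simp [← h]
  have hp : 0 < price b j := h.trans_le (hb.le_price i j)
  have hρ' := (hρ i).ne'
  rw [Real.log_div (mul_pos (ha i j) (Real.rpow_pos_of_pos h _)).ne'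
      (Real.rpow_pos_of_pos hp _).ne',
    Real.log_mul (ha i j).ne' (Real.rpow_pos_of_pos h _).ne', Real.log_rpow h, Real.log_rpow hp,
    logCost]
  field_simp
  ring

end Market

/-- Summand of Gibbs' inequality. -/
lemma sub_le_mul_log_sub_log {x y : ℝ} (hx : 0 ≤ x) (hy : 0 ≤ y) (h : 0 < x → 0 < y) :
    x - y ≤ x * (Real.log x - Real.log y) := by
  rcases hx.eq_or_lt with rfl | hx
  · simpa using hy
  have hy := h hx
  have := mul_le_mul_of_nonneg_left (Real.log_le_sub_one_of_pos (div_pos hy hx)) hx.le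
  rw [Real.log_div hy.ne' hx.ne', mul_sub, mul_sub, mul_div_cancel₀ _ hx.ne'] at this
  linarith

/-- The potential lies above its linearization at `b`, which equals
`∑ i, ∑ j, b' i j * logCost …` since feasible spendings have equal totals. -/
lemma sum_mul_logCost_le_Phi {m n : ℕ} {e : Fin m → ℝ} {a : Fin m → Fin n → ℝ} {ρ : Fin m → ℝ}
    (ha : ∀ i j, 0 < a i j) (hρ : ∀ i, 0 < ρ i ∧ ρ i ≤ 1)
    {b b' : Fin m → Fin n → ℝ} (hb : Feasible e b) (hb' : Feasible e b')
    (hp : ∀ j, 0 < price b j) (hpos : ∀ i j, ρ i < 1 → 0 < b' i j → 0 < b i j) :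
    ∑ i, ∑ j, b' i j * logCost (a i j) (ρ i) (price b j) (b i j) ≤ Phi a ρ b' := by
  rw [hb'.Phi_eq ha fun i => (hρ i).1, ← sub_nonneg]
  have key : ∑ i, ∑ j, b' i j * logCost (a i j) (ρ i) (price b' j) (b' i j) -
      ∑ i, ∑ j, b' i j * logCost (a i j) (ρ i) (price b j) (b i j) =
      ∑ j, price b' j * (Real.log (price b' j) - Real.log (price b j)) +
        ∑ i, (1 / ρ i - 1) * ∑ j, b' i j * (Real.log (b' i j) - Real.log (b i j)) := by
    have h : ∑ j, price b' j * (Real.log (price b' j) - Real.log (price b j)) =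
        ∑ i, ∑ j, b' i j * (Real.log (price b' j) - Real.log (price b j)) := by
      rw [sum_comm]
      exact sum_congr rfl fun j _ => by rw [← sum_mul]; rfl
    rw [h, ← sum_sub_distrib, ← sum_add_distrib]
    refine sum_congr rfl fun i _ => ?_
    rw [mul_sum, ← sum_sub_distrib, ← sum_add_distrib]
    exact sum_congr rfl fun j _ => by simp only [logCost]; ring
  have total : ∀ c : Fin m → Fin n → ℝ, Feasible e c → ∑ j, price c j = ∑ i, e i := by
    intro c hc
    simp only [price]
    rw [sum_comm]
    exact sum_congr rfl fun i _ => (hc i).2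
  rw [key]
  refine add_nonneg ?_ (sum_nonneg fun i _ => ?_)
  · calc (0 : ℝ) = ∑ j, (price b' j - price b j) := by
          rw [sum_sub_distrib, total b hb, total b' hb', sub_self]
      _ ≤ _ := sum_le_sum fun j _ =>
          sub_le_mul_log_sub_log (hb'.price_nonneg j) (hp j).le fun _ => hp j
  · rcases (hρ i).2.eq_or_lt with h1 | h1
    · simp [h1]
    refine mul_nonneg (sub_nonneg.2 (one_le_one_div (hρ i).1 h1.le)) ?_
    calc (0 : ℝ) = ∑ j, (b' i j - b i j) := by
          rw [sum_sub_distrib, (hb i).2, (hb' i).2, sub_self]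
      _ ≤ _ := sum_le_sum fun j _ =>
          sub_le_mul_log_sub_log ((hb' i).1 j) ((hb i).1 j) (hpos i j h1)

open Filter Topology in
/-- First-order optimality passes to the limit along small transfers. -/
lemma le_of_forall_transfer_le {c x y : ℝ} (hc : 0 ≤ c) (hx : 0 < x) (hy : 0 ≤ y) {P Q : ℝ → ℝ}
    (hP : ContinuousAt P 0) (hQ : ContinuousAt Q 0)
    (h : ∀ t, 0 < t → t < x → P t + c * Real.log (x - t) ≤ Q t + c * Real.log (y + t)) :
    (0 < c → 0 < y) ∧ P 0 + c * Real.log x ≤ Q 0 + c * Real.log y := by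
  have hev : ∀ᶠ t in 𝓝[>] (0 : ℝ),
      P t + c * Real.log (x - t) ≤ Q t + c * Real.log (y + t) := by
    filter_upwards [Ioo_mem_nhdsGT hx] with t ht using h t ht.1 ht.2
  have hP' : Tendsto P (𝓝[>] 0) (𝓝 (P 0)) := hP.tendsto.mono_left nhdsWithin_le_nhds
  have hQ' : Tendsto Q (𝓝[>] 0) (𝓝 (Q 0)) := hQ.tendsto.mono_left nhdsWithin_le_nhds
  have hlx : Tendsto (fun t => Real.log (x - t)) (𝓝[>] 0) (𝓝 (Real.log x)) := by
    have : ContinuousAt (fun t => Real.log (x - t)) 0 :=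
      ContinuousAt.log (by fun_prop) (by simpa using hx.ne')
    simpa using this.tendsto.mono_left nhdsWithin_le_nhds
  have hL := hP'.add (hlx.const_mul c)
  rcases hc.eq_or_lt with rfl | hc
  · refine ⟨fun h => absurd h (lt_irrefl _), ?_⟩
    simpa using le_of_tendsto_of_tendsto hP' hQ' (by simpa [EventuallyLE] using hev)
  rcases hy.eq_or_lt with rfl | hy
  · exfalso
    have hbot : Tendsto (fun t => Q t + c * Real.log (0 + t)) (𝓝[>] 0) atBot := by
      simpa using! hQ'.add_atBot (Real.tendsto_log_nhdsGT_zero.const_mul_atBot hc)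
    exact not_tendsto_atBot_of_tendsto_nhds hL (tendsto_atBot_mono' _ hev hbot)
  refine ⟨fun _ => hy, ?_⟩
  have hly : Tendsto (fun t => Real.log (y + t)) (𝓝[>] 0) (𝓝 (Real.log y)) := by
    have : ContinuousAt (fun t => Real.log (y + t)) 0 :=
      ContinuousAt.log (by fun_prop) (by simpa using hy.ne')
    simpa using this.tendsto.mono_left nhdsWithin_le_nhds
  exact le_of_tendsto_of_tendsto hL (hQ'.add (hly.const_mul c)) hev

/-- Tangent line inequality for the concave function `x ↦ x ^ r`. -/
lemma rpow_le_rpow_add_mul_sub {r x y : ℝ} (hr : 0 < r) (hr1 : r ≤ 1) (hx : 0 ≤ x) (hy : 0 ≤ y)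
    (h : r < 1 → 0 < x → 0 < y) :
    x ^ r ≤ y ^ r + r * (y ^ (r - 1) * (x - y)) := by
  rcases hr1.eq_or_lt with rfl | hr1
  · simp
  rcases hy.eq_or_lt with rfl | hy
  · obtain rfl : x = 0 := le_antisymm (not_lt.1 fun hx => (h hr1 hx).false) hx
    simp
  have key := rpow_one_add_le_one_add_mul_self (s := x / y - 1) (p := r)
    (by linarith [div_nonneg hx hy.le]) hr.le hr1.le
  rw [add_sub_cancel, Real.div_rpow hx hy.le, div_le_iff₀ (Real.rpow_pos_of_pos hy _)] at key
  refine key.trans_eq ?_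
  rw [Real.rpow_sub_one hy.ne']
  field_simp

lemma mul_rpow_sub_one_eq_exp_logCost {a r p s : ℝ} (ha : 0 < a) (hr : 0 < r) (hp : 0 < p)
    (hr1 : r ≤ 1) (h : r < 1 → 0 < s) :
    a * (s / p) ^ (r - 1) = Real.exp (-(r * logCost a r p s)) * p := by
  have hlog : a = Real.exp (Real.log a) := (Real.exp_log ha).symm
  rcases hr1.eq_or_lt with rfl | hr1
  · simp [logCost, Real.exp_sub, Real.exp_log ha, Real.exp_log hp, hp.ne']
  have hs := h hr1
  rw [Real.rpow_def_of_pos (div_pos hs hp), Real.log_div hs.ne' hp.ne']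
  nth_rw 1 [hlog]
  rw [← Real.exp_add]
  conv_rhs => enter [2]; rw [← Real.exp_log hp]
  rw [← Real.exp_add, logCost]
  congr 1
  field_simp
  ring

section Optimality

variable {m n : ℕ} {e : Fin m → ℝ} {a : Fin m → Fin n → ℝ} {ρ : Fin m → ℝ}
  {b : Fin m → Fin n → ℝ}

lemma Feasible.exists_pos (hb : Feasible e b) {i : Fin m} (he : 0 < e i) : ∃ j, 0 < b i j := by
  obtain ⟨j, -, hj⟩ := exists_lt_of_sum_lt (s := univ) (f := fun _ => (0 : ℝ)) (g := b i)
    (by simpa [(hb i).2] using he)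
  exact ⟨j, hj⟩

lemma MinimizesLogCost.Phi_le (h : MinimizesLogCost a ρ b) (he : ∀ i, 0 < e i)
    (ha : ∀ i j, 0 < a i j) (hρ : ∀ i, 0 < ρ i ∧ ρ i ≤ 1) (hb : Feasible e b)
    (hp : ∀ j, 0 < price b j) {b' : Fin m → Fin n → ℝ} (hb' : Feasible e b') :
    Phi a ρ b ≤ Phi a ρ b' := by
  choose f hf using fun i => hb.exists_pos (he i)
  refine le_trans ?_ (sum_mul_logCost_le_Phi ha hρ hb hb' hp
    fun i j h1 _ => (h i (f i) j (hf i)).1 h1)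
  rw [hb.Phi_eq ha fun i => (hρ i).1]
  refine sum_le_sum fun i _ => ?_
  set g := fun j => logCost (a i j) (ρ i) (price b j) (b i j)
  calc ∑ j, b i j * g j ≤ ∑ j, b i j * g (f i) := by
        refine sum_le_sum fun j _ => ?_
        rcases ((hb i).1 j).eq_or_lt with h0 | h0
        · simp [← h0]
        · exact mul_le_mul_of_nonneg_left (h i j (f i) h0).2 h0.le
    _ = ∑ j, b' i j * g (f i) := by rw [← sum_mul, ← sum_mul, (hb i).2, (hb' i).2]
    _ ≤ ∑ j, b' i j * g j := sum_le_sum fun j _ =>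
        mul_le_mul_of_nonneg_left (h i (f i) j (hf i)).2 ((hb' i).1 j)

lemma minimizesLogCost_of_Phi_le (ha : ∀ i j, 0 < a i j) (hρ : ∀ i, 0 < ρ i ∧ ρ i ≤ 1)
    (hb : Feasible e b) (hp : ∀ j, 0 < price b j)
    (h : ∀ b', Feasible e b' → Phi a ρ b ≤ Phi a ρ b') : MinimizesLogCost a ρ b := by
  intro i j k hj
  by_cases hjk : j = k
  · subst hjk
    exact ⟨fun _ => hj, le_rfl⟩
  have hc : 0 ≤ 1 / ρ i - 1 := sub_nonneg.2 (one_le_one_div (hρ i).1 (hρ i).2)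
  have key := le_of_forall_transfer_le hc hj ((hb i).1 k)
    (P := fun t => Real.log (price b j - t) - Real.log (a i j) / ρ i)
    (Q := fun t => Real.log (price b k + t) - Real.log (a i k) / ρ i)
    ((ContinuousAt.log (by fun_prop) (by simpa using (hp j).ne')).sub continuousAt_const)
    ((ContinuousAt.log (by fun_prop) (by simpa using (hp k).ne')).sub continuousAt_const) ?_
  · refine ⟨fun h1 => key.1 (sub_pos.2 (one_lt_one_div (hρ i).1 h1)), ?_⟩
    simpa [logCost] using key.2
  intro t ht htj
  set c := Function.update b i (transfer (b i) j k t) with hcdef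
  have hcf : Feasible e c := hb.update_transfer hjk ht.le htj.le
  have hcp : price c = transfer (price b) j k t := price_update_transfer b i j k t
  have hci : c i = transfer (b i) j k t := by simp [hcdef]
  have hle := (sum_mul_logCost_le_Phi ha hρ hcf hb
    (fun l => by
      rw [hcp]
      exact transfer_pos hjk ht.le (htj.trans_le (hb.le_price i j)) (hp l))
    (fun i' l _ hl => by
      by_cases hi : i' = i
      · subst hi
        rw [hci]
        exact transfer_pos hjk ht.le htj hl
      · simpa [hcdef, hi] using hl)).trans (h c hcf)
  rw [hcf.Phi_eq ha fun i => (hρ i).1, ← add_sum_erase _ _ (mem_univ i),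
    ← add_sum_erase univ (fun i => ∑ j, c i j * logCost (a i j) (ρ i) (price c j) (c i j))
      (mem_univ i)] at hle
  have hrest : ∑ i' ∈ univ.erase i, ∑ l, b i' l * logCost (a i' l) (ρ i') (price c l) (c i' l) =
      ∑ i' ∈ univ.erase i, ∑ l, c i' l * logCost (a i' l) (ρ i') (price c l) (c i' l) := by
    refine sum_congr rfl fun i' hi => ?_
    rw [show c i' = b i' by simp [hcdef, ne_of_mem_erase hi]]
  rw [hrest] at hle
  have hle := le_of_add_le_add_right hle
  have hsum := sum_mul_transfer (v := b i) (j := j) (k := k) (t := t)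
    (fun l => logCost (a i l) (ρ i) (price c l) (c i l))
  rw [← hci] at hsum
  simp only [mul_comm (b i _), mul_comm (c i _)] at hle
  rw [hsum] at hle
  have := nonneg_of_mul_nonneg_right (le_add_iff_nonneg_right _ |>.1 hle) ht
  simpa only [hcp, hci, transfer_source hjk, transfer_target hjk, logCost] using sub_nonneg.1 this

lemma MinimizesLogCost.isMaxOn (h : MinimizesLogCost a ρ b) {i : Fin m} (he : 0 < e i)
    (ha : ∀ i j, 0 < a i j) (hρ : ∀ i, 0 < ρ i ∧ ρ i ≤ 1) (hb : Feasible e b)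
    (hp : ∀ j, 0 < price b j) :
    IsMaxOn (fun x : Fin n → ℝ => (∑ j, a i j * x j ^ ρ i) ^ (1 / ρ i))
      {x : Fin n → ℝ | (∀ j, 0 ≤ x j) ∧ ∑ j, price b j * x j ≤ e i}
      (fun j => b i j / price b j) := by
  rintro x ⟨hx, hxe⟩
  obtain ⟨hr, hr1⟩ := hρ i
  obtain ⟨f, hf⟩ := hb.exists_pos he
  refine Real.rpow_le_rpow (sum_nonneg fun j _ => mul_nonneg (ha i j).le
    (Real.rpow_nonneg (hx j) _)) ?_ (one_div_pos.2 hr).le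
  set w := fun j => Real.exp (-(ρ i * logCost (a i j) (ρ i) (price b j) (b i j)))
  have htangent : ∀ j, a i j * x j ^ ρ i ≤ a i j * (b i j / price b j) ^ ρ i +
      ρ i * (w j * (price b j * x j) - w j * b i j) := by
    intro j
    have := mul_le_mul_of_nonneg_left (rpow_le_rpow_add_mul_sub hr hr1 (hx j)
      (div_nonneg ((hb i).1 j) (hp j).le)
      fun h1 _ => div_pos ((h i f j hf).1 h1) (hp j)) (ha i j).le
    refine this.trans_eq ?_
    have hexp := mul_rpow_sub_one_eq_exp_logCost (ha i j) hr (hp j) hr1 (h i f j hf).1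
    have hpb : price b j * (b i j / price b j) = b i j := mul_div_cancel₀ _ (hp j).ne'
    linear_combination ρ i * (x j - b i j / price b j) * hexp - ρ i * w j * hpb
  have hwle : ∀ j k, 0 < b i j → w k ≤ w j := fun j k hj =>
    Real.exp_le_exp.2 (neg_le_neg (mul_le_mul_of_nonneg_left (h i j k hj).2 hr.le))
  have hgain : ∑ j, (w j * (price b j * x j) - w j * b i j) ≤ 0 := by
    calc ∑ j, (w j * (price b j * x j) - w j * b i j)
        ≤ ∑ j, (w f * (price b j * x j) - w f * b i j) := by
          refine sum_le_sum fun j _ => sub_le_sub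
            (mul_le_mul_of_nonneg_right (hwle f j hf) (mul_nonneg (hp j).le (hx j))) ?_
          rcases ((hb i).1 j).eq_or_lt with h0 | h0
          · simp [← h0]
          · exact mul_le_mul_of_nonneg_right (hwle j f h0) h0.le
      _ = w f * (∑ j, price b j * x j - e i) := by
          rw [sum_sub_distrib, ← mul_sum, ← mul_sum, (hb i).2, mul_sub]
      _ ≤ 0 := mul_nonpos_of_nonneg_of_nonpos (Real.exp_pos _).le (sub_nonpos.2 hxe)
  calc ∑ j, a i j * x j ^ ρ i
      ≤ ∑ j, (a i j * (b i j / price b j) ^ ρ i +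
          ρ i * (w j * (price b j * x j) - w j * b i j)) := sum_le_sum fun j _ => htangent j
    _ = ∑ j, a i j * (b i j / price b j) ^ ρ i +
          ρ i * ∑ j, (w j * (price b j * x j) - w j * b i j) := by
        rw [sum_add_distrib, mul_sum]
    _ ≤ _ := add_le_of_nonpos_right (mul_nonpos_of_nonneg_of_nonpos hr.le hgain)

lemma minimizesLogCost_of_isMaxOn (ha : ∀ i j, 0 < a i j) (hρ : ∀ i, 0 < ρ i ∧ ρ i ≤ 1)
    (hb : Feasible e b) (hp : ∀ j, 0 < price b j)
    (h : ∀ i, IsMaxOn (fun x : Fin n → ℝ => (∑ j, a i j * x j ^ ρ i) ^ (1 / ρ i))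
      {x : Fin n → ℝ | (∀ j, 0 ≤ x j) ∧ ∑ j, price b j * x j ≤ e i}
      (fun j => b i j / price b j)) : MinimizesLogCost a ρ b := by
  intro i j k hj
  by_cases hjk : j = k
  · subst hjk
    exact ⟨fun _ => hj, le_rfl⟩
  obtain ⟨hr, hr1⟩ := hρ i
  have hc : 0 ≤ 1 / ρ i - 1 := sub_nonneg.2 (one_le_one_div hr hr1)
  have key := le_of_forall_transfer_le hc hj ((hb i).1 k)
    (P := fun _ => Real.log (price b j) - Real.log (a i j) / ρ i)
    (Q := fun _ => Real.log (price b k) - Real.log (a i k) / ρ i)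
    continuousAt_const continuousAt_const ?_
  · exact ⟨fun h1 => key.1 (sub_pos.2 (one_lt_one_div hr h1)), key.2⟩
  intro t ht htj
  set c := transfer (b i) j k t with hcdef
  have hc0 : ∀ l, 0 ≤ c l := transfer_nonneg (hb i).1 hjk ht.le htj.le
  have hcj : c j = b i j - t := transfer_source hjk
  have hck : c k = b i k + t := transfer_target hjk
  set w := fun l => a i l * (c l / price b l) ^ (ρ i - 1) / price b l with hw
  have hmax := h i (show (fun l => c l / price b l) ∈ {x : Fin n → ℝ | (∀ j, 0 ≤ x j) ∧
      ∑ j, price b j * x j ≤ e i} by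
    refine ⟨fun l => div_nonneg (hc0 l) (hp l).le, ?_⟩
    simp only [mul_div_cancel₀ _ (hp _).ne']
    exact (sum_transfer.trans (hb i).2).le)
  have hU : ∑ l, a i l * (c l / price b l) ^ ρ i ≤ ∑ l, a i l * (b i l / price b l) ^ ρ i :=
    (Real.rpow_le_rpow_iff
      (sum_nonneg fun l _ => mul_nonneg (ha i l).le
        (Real.rpow_nonneg (div_nonneg (hc0 l) (hp l).le) _))
      (sum_nonneg fun l _ => mul_nonneg (ha i l).le
        (Real.rpow_nonneg (div_nonneg ((hb i).1 l) (hp l).le) _))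
      (one_div_pos.2 hr)).1 hmax
  have htangent : ∑ l, a i l * (b i l / price b l) ^ ρ i ≤
      ∑ l, (a i l * (c l / price b l) ^ ρ i + ρ i * (w l * b i l - w l * c l)) := by
    refine sum_le_sum fun l _ => ?_
    have := mul_le_mul_of_nonneg_left (rpow_le_rpow_add_mul_sub hr hr1
      (div_nonneg ((hb i).1 l) (hp l).le) (div_nonneg (hc0 l) (hp l).le)
      fun _ hl => div_pos (transfer_pos hjk ht.le htj ((div_pos_iff_of_pos_right (hp l)).1 hl))
        (hp l)) (ha i l).le
    refine this.trans_eq ?_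
    simp only [hw]
    ring
  rw [sum_add_distrib, ← mul_sum, sum_sub_distrib, hcdef, sum_mul_transfer, ← hcdef] at htangent
  have hwkj : w k ≤ w j := by
    have h0 : 0 ≤ ρ i * (t * (w j - w k)) := by linarith
    linarith [nonneg_of_mul_nonneg_right (nonneg_of_mul_nonneg_right h0 hr) ht]
  have hwexp : ∀ l, 0 < c l →
      w l = Real.exp (-(ρ i * logCost (a i l) (ρ i) (price b l) (c l))) := by
    intro l hl
    simp only [hw]
    rw [mul_rpow_sub_one_eq_exp_logCost (ha i l) hr (hp l) hr1 fun _ => hl,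
      mul_div_cancel_right₀ _ (hp l).ne']
  rw [hwexp k (by rw [hck]; linarith [(hb i).1 k]), hwexp j (by rw [hcj]; linarith),
    Real.exp_le_exp, neg_le_neg_iff, hcj, hck] at hwkj
  exact le_of_mul_le_mul_left hwkj hr

end Optimality

/-- In a Fisher market with CES substitutes utilities
(`0 < ρ_i ≤ 1`), a feasible spending vector is an equilibrium spending (each buyer's
induced bundle maximizes her utility over her budget set) iff it minimizes the
potential `Φ` over the feasible set. -/
theorem equilibrium_iff_minimizer_of_Phi {m n : ℕ}
    (e : Fin m → ℝ) (he : ∀ i, 0 < e i)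
    (a : Fin m → Fin n → ℝ) (ha : ∀ i j, 0 < a i j)
    (ρ : Fin m → ℝ) (hρ : ∀ i, 0 < ρ i ∧ ρ i ≤ 1)
    (b : Fin m → Fin n → ℝ) (hb : Feasible e b)
    (hp : ∀ j, 0 < price b j) :
    (∀ i, IsMaxOn (fun x : Fin n → ℝ => (∑ j, a i j * x j ^ ρ i) ^ (1 / ρ i))
        {x : Fin n → ℝ | (∀ j, 0 ≤ x j) ∧ ∑ j, price b j * x j ≤ e i}
        (fun j => b i j / price b j)) ↔
      (∀ b', Feasible e b' → Phi a ρ b ≤ Phi a ρ b') := by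
  exact ⟨fun h _ hb' => (minimizesLogCost_of_isMaxOn ha hρ hb hp h).Phi_le he ha hρ hb hp hb',
    fun h i => (minimizesLogCost_of_Phi_le ha hρ hb hp h).isMaxOn (he i) ha hρ hb hp⟩
end

section
/- Suppose every buyer has a complementary CES utility (ρ_i ∈ [−∞,0)) and all buyers repeatedly update their spending by the complementary Proportional Response rule: b_ij^{t+1} = e_i · (a_ij / p_j(b^t)^{ρ_i})^{1/(1−ρ_i)} / Σ_k (a_ik / p_k(b^t)^{ρ_i})^{1/(1−ρ_i)} for −∞ < ρ_i < 0, and b_ij^{t+1} = e_i · c_ij p_j(b^t) / Σ_k c_ik p_k(b^t) for ρ_i = −∞, starting from an entrywise positive feasible b^0. Let b* be a maximizer of Φ over the feasible set. Then for all T ≥ 1: Φ(b*) − Φ(b^T) ≤ (1/T) · Σ_i ((ρ_i−1)/ρ_i)·KL(b_i* ‖ b_i^0), where (ρ_i−1)/ρ_i is defined to equal 1 when ρ_i = −∞. -/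
open Finset

lemma mul_log_div_eq {x y : ℝ} (hy : 0 < y) :
    x * Real.log (x / y) = x * (Real.log x - Real.log y) := by
  rcases eq_or_ne x 0 with rfl | hx
  · simp
  · rw [Real.log_div hx hy.ne']

lemma KL_nonneg {n : ℕ} {x y : Fin n → ℝ} (hx : ∀ j, 0 ≤ x j) (hy : ∀ j, 0 < y j)
    (hxy : ∑ j, x j = ∑ j, y j) : 0 ≤ KL x y := by
  calc (0 : ℝ) = ∑ j, (x j - y j) := by rw [sum_sub_distrib, hxy, sub_self]
    _ ≤ KL x y := sum_le_sum fun j _ => sub_le_mul_log_div (hx j) (hy j)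

/-- The log-sum inequality. -/
lemma sum_mul_log_div_sum_le {m : ℕ} {x y : Fin m → ℝ} (hx : ∀ i, 0 ≤ x i)
    (hy : ∀ i, 0 < y i) :
    (∑ i, x i) * Real.log ((∑ i, x i) / ∑ i, y i) ≤ ∑ i, x i * Real.log (x i / y i) := by
  rcases (sum_nonneg fun i _ => hx i : 0 ≤ ∑ i, x i).eq_or_lt with h0 | hP
  · have hx0 : ∀ i, x i = 0 := fun i =>
      (sum_eq_zero_iff_of_nonneg fun i _ => hx i).1 h0.symm i (mem_univ i)
    simp [hx0]
  · have hQ : 0 < ∑ i, y i := by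
      refine sum_pos (fun i _ => hy i) ?_
      by_contra h
      rw [not_nonempty_iff_eq_empty] at h
      simp [h] at hP
    set P := ∑ i, x i
    set Q := ∑ i, y i
    have hterm : ∀ i, x i - y i * (P / Q) ≤
        x i * Real.log (x i / y i) - x i * Real.log (P / Q) := fun i => by
      have hr := div_pos hP hQ
      have h := sub_le_mul_log_div (hx i) (mul_pos (hy i) hr)
      rw [mul_log_div_eq (mul_pos (hy i) hr), Real.log_mul (hy i).ne' hr.ne'] at h
      rw [mul_log_div_eq (hy i)]
      linarith
    have h := sum_le_sum fun i (_ : i ∈ univ) => hterm i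
    rw [sum_sub_distrib, sum_sub_distrib, ← sum_mul, ← sum_mul] at h
    have hPQ : Q * (P / Q) = P := by field_simp
    change P - Q * (P / Q) ≤ _ - P * _ at h
    linarith

lemma KL_price_le_sum_KL {m n : ℕ} {b b' : Fin m → Fin n → ℝ} (hb : ∀ i j, 0 ≤ b i j)
    (hb' : ∀ i j, 0 < b' i j) : KL (price b) (price b') ≤ ∑ i, KL (b i) (b' i) := by
  unfold KL
  rw [sum_comm]
  exact sum_le_sum fun j _ => sum_mul_log_div_sum_le (fun i => hb i j) fun i => hb' i j

lemma sum_price {m n : ℕ} {e : Fin m → ℝ} {b : Fin m → Fin n → ℝ} (hb : Feasible e b) :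
    ∑ j, price b j = ∑ i, e i := by
  unfold price
  rw [sum_comm]
  exact sum_congr rfl fun i _ => (hb i).2

lemma price_pos {m n : ℕ} {b : Fin m → Fin n → ℝ} (hb : ∀ i j, 0 < b i j) (i : Fin m)
    (j : Fin n) : 0 < price b j :=
  sum_pos (fun i _ => hb i j) ⟨i, mem_univ i⟩

/-- The potential with the price terms frozen at `q`. -/
noncomputable def surrogate {m n : ℕ} (α : Fin m → Fin n → ℝ) (γ : Fin m → ℝ)
    (b : Fin m → Fin n → ℝ) (q : Fin n → ℝ) : ℝ :=
  ∑ i, ∑ j, b i j * (α i j - γ i * Real.log (b i j) + Real.log (q j))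

lemma surrogate_price_eq_add_KL {m n : ℕ} (α : Fin m → Fin n → ℝ) (γ : Fin m → ℝ)
    (b : Fin m → Fin n → ℝ) {q : Fin n → ℝ} (hq : ∀ j, 0 < q j) :
    surrogate α γ b (price b) = surrogate α γ b q + KL (price b) q := by
  have hKL : KL (price b) q =
      ∑ i, ∑ j, b i j * (Real.log (price b j) - Real.log (q j)) := by
    unfold KL
    rw [sum_comm]
    refine sum_congr rfl fun j _ => ?_
    rw [mul_log_div_eq (hq j), ← sum_mul]
    rfl
  rw [hKL]
  simp only [surrogate, ← sum_add_distrib]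
  exact sum_congr rfl fun i _ => sum_congr rfl fun j _ => by ring

lemma surrogate_eq_sub_KL {m n : ℕ} {α : Fin m → Fin n → ℝ} {γ : Fin m → ℝ}
    {e z : Fin m → ℝ} {b b' : Fin m → Fin n → ℝ} {q : Fin n → ℝ} (hb : Feasible e b)
    (hb' : ∀ i j, 0 < b' i j)
    (h : ∀ i j, γ i * Real.log (b' i j) = α i j + Real.log (q j) - z i) :
    surrogate α γ b q = ∑ i, e i * z i - ∑ i, γ i * KL (b i) (b' i) := by
  unfold surrogate KL
  rw [← sum_sub_distrib]
  refine sum_congr rfl fun i _ => ?_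
  rw [← (hb i).2, sum_mul, mul_sum, ← sum_sub_distrib]
  refine sum_congr rfl fun j _ => ?_
  rw [mul_log_div_eq (hb' i j)]
  linear_combination (-b i j) * h i j

lemma KL_self {n : ℕ} {x : Fin n → ℝ} (hx : ∀ j, 0 < x j) : KL x x = 0 :=
  sum_eq_zero fun j _ => by simp [div_self (hx j).ne']

section Ascent

variable {m n : ℕ} {α : Fin m → Fin n → ℝ} {γ e z : Fin m → ℝ} {b b' : Fin m → Fin n → ℝ}

lemma surrogate_le_potential (i₀ : Fin m) (hb : Feasible e b) (hbpos : ∀ i j, 0 < b i j)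
    (hb' : Feasible e b') :
    surrogate α γ b' (price b) ≤ surrogate α γ b' (price b') := by
  rw [surrogate_price_eq_add_KL α γ b' (price_pos hbpos i₀)]
  have := KL_nonneg (x := price b') (y := price b)
    (fun j => sum_nonneg fun i _ => (hb' i).1 j) (price_pos hbpos i₀)
    ((sum_price hb').trans (sum_price hb).symm)
  linarith

lemma potential_le_of_step (i₀ : Fin m) (hγ : ∀ i, 1 ≤ γ i)
    (hb : Feasible e b) (hbpos : ∀ i j, 0 < b i j)
    (hb' : Feasible e b') (hbpos' : ∀ i j, 0 < b' i j)
    (h : ∀ i j, γ i * Real.log (b' i j) = α i j + Real.log (price b j) - z i) :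
    surrogate α γ b (price b) ≤ surrogate α γ b' (price b') := by
  refine le_trans ?_ (surrogate_le_potential i₀ hb hbpos hb')
  rw [surrogate_eq_sub_KL hb hbpos' h, surrogate_eq_sub_KL hb' hbpos' h]
  refine sub_le_sub_left (sum_le_sum fun i _ => ?_) _
  rw [KL_self (hbpos' i), mul_zero]
  exact mul_nonneg (zero_le_one.trans (hγ i))
    (KL_nonneg (hb i).1 (hbpos' i) ((hb i).2.trans (hb' i).2.symm))

lemma potential_gap_le_of_step (i₀ : Fin m) (hγ : ∀ i, 1 ≤ γ i)
    (hb : Feasible e b) (hbpos : ∀ i j, 0 < b i j)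
    (hb' : Feasible e b') (hbpos' : ∀ i j, 0 < b' i j)
    (h : ∀ i j, γ i * Real.log (b' i j) = α i j + Real.log (price b j) - z i)
    {s : Fin m → Fin n → ℝ} (hs : Feasible e s) :
    surrogate α γ s (price s) - surrogate α γ b' (price b') ≤
      ∑ i, γ i * KL (s i) (b i) - ∑ i, γ i * KL (s i) (b' i) := by
  have h₁ := surrogate_le_potential (α := α) (γ := γ) i₀ hb hbpos hb'
  rw [surrogate_eq_sub_KL hb' hbpos' h] at h₁
  simp only [KL_self (hbpos' _), mul_zero, sum_const_zero, sub_zero] at h₁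
  have h₂ := surrogate_price_eq_add_KL α γ s (price_pos hbpos i₀)
  rw [surrogate_eq_sub_KL hs hbpos' h] at h₂
  have h₃ := KL_price_le_sum_KL (fun i => (hs i).1) hbpos
  have h₄ : ∑ i, KL (s i) (b i) ≤ ∑ i, γ i * KL (s i) (b i) :=
    sum_le_sum fun i _ => le_mul_of_one_le_left
      (KL_nonneg (hs i).1 (hbpos i) ((hs i).2.trans (hb i).2.symm)) (hγ i)
  linarith

end Ascent

lemma le_div_of_monotone_of_telescoping {F D : ℕ → ℝ} {s : ℝ}
    (hF : ∀ t, F t ≤ F (t + 1)) (hD : ∀ t, 0 ≤ D t)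
    (h : ∀ t, s - F (t + 1) ≤ D t - D (t + 1)) {T : ℕ} (hT : 1 ≤ T) :
    s - F T ≤ (1 / (T : ℝ)) * D 0 := by
  have hT' : (0 : ℝ) < T := by exact_mod_cast hT
  have hsum : ∀ N : ℕ, (N : ℝ) * (s - F N) ≤ D 0 - D N := by
    intro N
    induction N with
    | zero => simp
    | succ N ih =>
      have h₁ : (N : ℝ) * (s - F (N + 1)) ≤ N * (s - F N) :=
        mul_le_mul_of_nonneg_left (by linarith [hF N]) N.cast_nonneg
      have h₂ := h N
      push_cast
      linarith
  rw [one_div, ← div_eq_inv_mul, le_div_iff₀ hT']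
  linarith [hsum T, hD T]

lemma PhiFull_eq_surrogate {m n : ℕ} {Leo : Finset (Fin m)} {a c : Fin m → Fin n → ℝ}
    {ρ : Fin m → ℝ} {b : Fin m → Fin n → ℝ}
    (ha : ∀ i ∉ Leo, ∀ j, 0 < a i j) (hc : ∀ i ∈ Leo, ∀ j, 0 < c i j)
    (hρ : ∀ i ∉ Leo, ρ i < 0) (hb : ∀ i j, 0 ≤ b i j) :
    PhiFull Leo a c ρ b =
      surrogate (fun i j => if i ∈ Leo then Real.log (c i j) else -(Real.log (a i j) / ρ i))
        (fun i => if i ∈ Leo then 1 else (ρ i - 1) / ρ i) b (price b) := by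
  unfold PhiFull surrogate
  rw [← sum_compl_add_sum Leo, sub_eq_add_neg, ← sum_neg_distrib, ← sum_neg_distrib]
  have hp : ∀ i j, 0 < b i j → 0 < price b j := fun i j h =>
    h.trans_le (single_le_sum (f := fun i => b i j) (fun i _ => hb i j) (mem_univ i))
  congr 1
  · refine sum_congr rfl fun i hi => ?_
    rw [mem_compl] at hi
    rw [mul_sum, ← sum_neg_distrib]
    refine sum_congr rfl fun j _ => ?_
    simp only [hi, if_false]
    rcases (hb i j).eq_or_lt with h0 | hpos
    · simp [← h0]
    · have hP := hp i j hpos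
      have hρi := (hρ i hi).ne
      rw [Real.log_div (mul_pos (ha i hi j) (Real.rpow_pos_of_pos hpos _)).ne'
          (Real.rpow_pos_of_pos hP _).ne',
        Real.log_mul (ha i hi j).ne' (Real.rpow_pos_of_pos hpos _).ne',
        Real.log_rpow hpos, Real.log_rpow hP]
      field_simp
      ring
  · refine sum_congr rfl fun i hi => ?_
    rw [← sum_neg_distrib]
    refine sum_congr rfl fun j _ => ?_
    simp only [hi, if_true]
    rcases (hb i j).eq_or_lt with h0 | hpos
    · simp [← h0]
    · have hP := hp i j hpos
      rw [Real.log_div hpos.ne' (mul_pos (hc i hi j) hP).ne',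
        Real.log_mul (hc i hi j).ne' hP.ne']
      ring

lemma sum_mul_div_sum {n : ℕ} {w : Fin n → ℝ} (hw : ∀ j, 0 < w j) (j₀ : Fin n) (r : ℝ) :
    ∑ j, r * w j / ∑ k, w k = r := by
  have hW : 0 < ∑ k, w k := sum_pos (fun j _ => hw j) ⟨j₀, mem_univ j₀⟩
  rw [← sum_div, ← mul_sum, mul_div_cancel_right₀ _ hW.ne']

lemma log_mul_div_sum {n : ℕ} {w : Fin n → ℝ} (hw : ∀ j, 0 < w j) {r : ℝ} (hr : 0 < r)
    (j : Fin n) :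
    Real.log (r * w j / ∑ k, w k) = Real.log (w j) - (Real.log (∑ k, w k) - Real.log r) := by
  have hW : 0 < ∑ k, w k := sum_pos (fun j _ => hw j) ⟨j, mem_univ j⟩
  rw [Real.log_div (mul_pos hr (hw j)).ne' hW.ne', Real.log_mul hr.ne' (hw j).ne']
  ring

/-- `O(1/T)` convergence of the complementary Proportional Response
for buyers with `ρ_i ∈ [-∞, 0)`, where `Leo` is the set of Leontief buyers
(`ρ_i = -∞`, for whom `(ρ_i - 1)/ρ_i` is defined to be `1`). -/
theorem proportional_response_complements_sublinear {m n : ℕ}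
    (Leo : Finset (Fin m))
    (e : Fin m → ℝ) (he : ∀ i, 0 < e i)
    (a c : Fin m → Fin n → ℝ)
    (ha : ∀ i ∉ Leo, ∀ j, 0 < a i j) (hc : ∀ i ∈ Leo, ∀ j, 0 < c i j)
    (ρ : Fin m → ℝ) (hρ : ∀ i ∉ Leo, ρ i < 0)
    (b : ℕ → Fin m → Fin n → ℝ)
    (hb0pos : ∀ i j, 0 < b 0 i j) (hb0 : Feasible e (b 0))
    -- the complementary Proportional Response update
    (hupdFin : ∀ t, ∀ i ∉ Leo, ∀ j, b (t + 1) i j =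
      e i * (a i j / price (b t) j ^ ρ i) ^ (1 / (1 - ρ i)) /
        ∑ k, (a i k / price (b t) k ^ ρ i) ^ (1 / (1 - ρ i)))
    (hupdLeo : ∀ t, ∀ i ∈ Leo, ∀ j, b (t + 1) i j =
      e i * (c i j * price (b t) j) / ∑ k, c i k * price (b t) k)
    -- b* maximizes Φ over the feasible set (equilibrium spending)
    (bstar : Fin m → Fin n → ℝ) (hbstarFeas : Feasible e bstar)
    (hbstarMax : ∀ b', Feasible e b' →
      PhiFull Leo a c ρ b' ≤ PhiFull Leo a c ρ bstar)
    (T : ℕ) (hT : 1 ≤ T) :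
    PhiFull Leo a c ρ bstar - PhiFull Leo a c ρ (b T) ≤
      (1 / (T : ℝ)) *
        ((∑ i ∈ Leoᶜ, ((ρ i - 1) / ρ i) * KL (bstar i) (b 0 i)) +
          ∑ i ∈ Leo, KL (bstar i) (b 0 i)) := by
  rcases isEmpty_or_nonempty (Fin m) with hm | ⟨⟨i₀⟩⟩
  · simp [PhiFull, eq_empty_of_isEmpty]
  have hn : Nonempty (Fin n) := by
    by_contra h
    rw [not_nonempty_iff] at h
    have h₀ := (hb0 i₀).2
    rw [univ_eq_empty, sum_empty] at h₀
    exact (he i₀).ne h₀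
  obtain ⟨j₀⟩ := hn
  set α : Fin m → Fin n → ℝ :=
    fun i j => if i ∈ Leo then Real.log (c i j) else -(Real.log (a i j) / ρ i) with hα
  set γ : Fin m → ℝ := fun i => if i ∈ Leo then 1 else (ρ i - 1) / ρ i with hγ
  have hγ1 : ∀ i, 1 ≤ γ i := fun i => by
    by_cases hi : i ∈ Leo
    · simp [hγ, hi]
    · simp only [hγ, hi, if_false]
      rw [le_div_iff_of_neg (hρ i hi)]
      linarith
  have hweights : ∀ t, (∀ i j, 0 < b t i j) → ∀ i, ∃ w : Fin n → ℝ, (∀ j, 0 < w j) ∧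
      (∀ j, b (t + 1) i j = e i * w j / ∑ k, w k) ∧
      ∀ j, γ i * Real.log (w j) = α i j + Real.log (price (b t) j) := by
    intro t hpos i
    have hp := price_pos hpos i
    by_cases hi : i ∈ Leo
    · refine ⟨fun j => c i j * price (b t) j, fun j => mul_pos (hc i hi j) (hp j),
        hupdLeo t i hi, fun j => ?_⟩
      simp only [hγ, hα, hi, if_true]
      rw [Real.log_mul (hc i hi j).ne' (hp j).ne', one_mul]
    · have hρi := hρ i hi
      have hq : ∀ j, 0 < a i j / price (b t) j ^ ρ i := fun j =>
        div_pos (ha i hi j) (Real.rpow_pos_of_pos (hp j) _)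
      refine ⟨fun j => (a i j / price (b t) j ^ ρ i) ^ (1 / (1 - ρ i)),
        fun j => Real.rpow_pos_of_pos (hq j) _, hupdFin t i hi, fun j => ?_⟩
      simp only [hγ, hα, hi, if_false]
      rw [Real.log_rpow (hq j), Real.log_div (ha i hi j).ne'
        (Real.rpow_pos_of_pos (hp j) _).ne', Real.log_rpow (hp j)]
      have h₁ : (1 : ℝ) - ρ i ≠ 0 := by linarith
      have h₂ := hρi.ne
      field_simp
      ring
  have hfeas : ∀ t, (∀ i j, 0 < b t i j) ∧ Feasible e (b t) := by
    intro t
    induction t with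
    | zero => exact ⟨hb0pos, hb0⟩
    | succ t ih =>
      have hpos : ∀ i j, 0 < b (t + 1) i j := fun i j => by
        obtain ⟨w, hw, hbw, -⟩ := hweights t ih.1 i
        rw [hbw]
        exact div_pos (mul_pos (he i) (hw j)) (sum_pos (fun j _ => hw j) ⟨j, mem_univ j⟩)
      refine ⟨hpos, fun i => ⟨fun j => (hpos i j).le, ?_⟩⟩
      obtain ⟨w, hw, hbw, -⟩ := hweights t ih.1 i
      simp only [hbw]
      exact sum_mul_div_sum hw j₀ (e i)
  have hstep : ∀ t, ∃ z : Fin m → ℝ, ∀ i j,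
      γ i * Real.log (b (t + 1) i j) = α i j + Real.log (price (b t) j) - z i := by
    intro t
    choose w hw hbw hlog using hweights t (hfeas t).1
    refine ⟨fun i => γ i * (Real.log (∑ k, w i k) - Real.log (e i)), fun i j => ?_⟩
    rw [hbw, log_mul_div_sum (hw i) (he i), ← hlog]
    ring
  choose z hz using hstep
  have hPhi : ∀ b', Feasible e b' →
      PhiFull Leo a c ρ b' = surrogate α γ b' (price b') := fun b' hb' =>
    PhiFull_eq_surrogate ha hc hρ fun i => (hb' i).1
  have hD : (∑ i ∈ Leoᶜ, ((ρ i - 1) / ρ i) * KL (bstar i) (b 0 i)) +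
      ∑ i ∈ Leo, KL (bstar i) (b 0 i) = ∑ i, γ i * KL (bstar i) (b 0 i) := by
    rw [← sum_compl_add_sum Leo fun i => γ i * KL (bstar i) (b 0 i)]
    congr 1
    · exact sum_congr rfl fun i hi => by simp only [hγ, mem_compl.1 hi, if_false]
    · exact sum_congr rfl fun i hi => by simp only [hγ, hi, if_true, one_mul]
  rw [hD, hPhi _ hbstarFeas, hPhi _ (hfeas T).2]
  exact le_div_of_monotone_of_telescoping
    (F := fun t => surrogate α γ (b t) (price (b t)))
    (D := fun t => ∑ i, γ i * KL (bstar i) (b t i))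
    (fun t => potential_le_of_step i₀ hγ1 (hfeas t).2 (hfeas t).1 (hfeas (t + 1)).2
      (hfeas (t + 1)).1 (hz t))
    (fun t => sum_nonneg fun i _ => mul_nonneg (zero_le_one.trans (hγ1 i))
      (KL_nonneg (hbstarFeas i).1 ((hfeas t).1 i)
        ((hbstarFeas i).2.trans ((hfeas t).2 i).2.symm)))
    (fun t => potential_gap_le_of_step i₀ hγ1 (hfeas t).2 (hfeas t).1 (hfeas (t + 1)).2
      (hfeas (t + 1)).1 (hz t) hbstarFeas) hT
end
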